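/- arXiv:1611.02922 — 9 statements merged into one kernel-verified Lean document; each statement's English description precedes it below -/
import Mathlib

section
/- Let α, β, γ, δ be integers with γ ≠ 0 and αδ − βγ ≠ 0, and set k = gcd(α, γ), α = k·α', γ = k·γ'. Let p, q be coprime integers with q > 0 such that γ·p ≠ α·q and |p/q − α'/γ'| < 1/(k·|γ'|) (as rational numbers). Then 0 < |α·q − γ·p| < q, and consequently the rational number (δ·p − β·q)/(α·q − γ·p) (the image of p/q under the inverse Möbius transformation of the matrix [[α,β],[γ,δ]]) has denominator in lowest terms strictly smaller than q. -/
/-- **Killer intervals (Long–Reid, Proposition 2.1).**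
Let `α β γ δ` be integers with `γ ≠ 0` and `α*δ - β*γ ≠ 0`, let `k = gcd(α,γ)` with
`α = k*α'`, `γ = k*γ'`.  If `p, q` are coprime integers with `q > 0`, `γ*p ≠ α*q`, and
`p/q` lies in the killer interval `(α'/γ' - 1/(k*|γ'|), α'/γ' + 1/(k*|γ'|))`, then
`0 < |α*q - γ*p| < q` and the rational `(δ*p - β*q)/(α*q - γ*p)` (the image of `p/q`
under the inverse Möbius transformation of `[[α,β],[γ,δ]]`) has denominator in lowest
terms strictly smaller than `q`. -/
theorem stmt_0 (α β γ δ α' γ' p q : ℤ)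
    (hγ : γ ≠ 0) (hdet : α * δ - β * γ ≠ 0)
    (hα : α = (Int.gcd α γ : ℤ) * α') (hγ2 : γ = (Int.gcd α γ : ℤ) * γ')
    (hpq : IsCoprime p q) (hq : 0 < q)
    (hne : γ * p ≠ α * q)
    (hint : |(p : ℚ) / (q : ℚ) - (α' : ℚ) / (γ' : ℚ)| <
      1 / ((Int.gcd α γ : ℚ) * |(γ' : ℚ)|)) :
    0 < |α * q - γ * p| ∧ |α * q - γ * p| < q ∧
      ((((δ * p - β * q : ℤ) : ℚ) / ((α * q - γ * p : ℤ) : ℚ)).den : ℤ) < q := by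
  have hγQ : (γ : ℚ) ≠ 0 := by exact_mod_cast hγ
  have hqQ : (0 : ℚ) < q := by exact_mod_cast hq
  have hk : (Int.gcd α γ : ℚ) ≠ 0 := by
    exact_mod_cast fun h => hγ (Int.gcd_eq_zero_iff.mp h).2
  have hαQ : (α : ℚ) = (Int.gcd α γ : ℚ) * α' := by exact_mod_cast hα
  have hγQ2 : (γ : ℚ) = (Int.gcd α γ : ℚ) * γ' := by exact_mod_cast hγ2
  have hcusp : (α' : ℚ) / γ' = α / γ := by
    rw [hαQ, hγQ2, mul_div_mul_left _ _ hk]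
  have hradius : (Int.gcd α γ : ℚ) * |(γ' : ℚ)| = |(γ : ℚ)| := by
    rw [hγQ2, abs_mul, Nat.abs_cast]
  have hpos : 0 < |α * q - γ * p| := abs_pos.mpr (sub_ne_zero.mpr hne.symm)
  have hlt : |α * q - γ * p| < q := by
    rw [hcusp, hradius, div_sub_div _ _ hqQ.ne' hγQ, abs_div, abs_mul, abs_of_pos hqQ,
      div_lt_div_iff₀ (by positivity) (by positivity), one_mul,
      mul_lt_mul_iff_left₀ (by positivity), abs_sub_comm, mul_comm (q : ℚ), mul_comm (p : ℚ)] at hint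
    exact_mod_cast hint
  refine ⟨hpos, hlt, lt_of_le_of_lt (Int.le_of_dvd hpos ((dvd_abs _ _).mpr ?_)) hlt⟩
  rw [← Rat.divInt_eq_div]
  exact Rat.den_dvd _ _
end

section
/- Let α, β, γ, δ be integers with γ ≠ 0 and αδ − βγ ≠ 0, set k = gcd(α, γ), α = k·α', γ = k·γ', and let n be an integer. Let h = Tⁿ·g·T⁻ⁿ where g = [[α,β],[γ,δ]] and T = [[1,1],[0,1]], i.e. h = [[α+nγ, β+nδ−n(α+nγ)],[γ, δ−nγ]]. Let p, q be coprime integers with q > 0 such that γ·(p−nq) ≠ α·q and |p/q − n − α'/γ'| < 1/(k·|γ'|). Then the rational number obtained by applying the inverse Möbius transformation of h to p/q has denominator in lowest terms strictly smaller than q. -/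
/-- **Shifted killer intervals (Long–Reid type, Proposition 2.3 of the paper).**
Let `α β γ δ` be integers with `γ ≠ 0` and `α*δ - β*γ ≠ 0`, set `k = gcd(α,γ)`,
`α = k*α'`, `γ = k*γ'`, and let `n` be an integer.  Let `h = Tⁿ g T⁻ⁿ` where
`g = [[α,β],[γ,δ]]` and `T = [[1,1],[0,1]]`, so `h = [[α+nγ, β+nδ-n(α+nγ)],[γ, δ-nγ]]`.
If `p, q` are coprime integers with `q > 0`, `γ*(p - n*q) ≠ α*q` and
`|p/q - n - α'/γ'| < 1/(k*|γ'|)`, then the rational obtained by applying the inverse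
Möbius transformation of `h` to `p/q` has denominator in lowest terms strictly
smaller than `q`. -/
theorem stmt_1 (α β γ δ α' γ' n p q : ℤ)
    (hγ : γ ≠ 0) (hdet : α * δ - β * γ ≠ 0)
    (hα : α = (Int.gcd α γ : ℤ) * α') (hγ2 : γ = (Int.gcd α γ : ℤ) * γ')
    (hpq : IsCoprime p q) (hq : 0 < q)
    (hne : γ * (p - n * q) ≠ α * q)
    (hint : |(p : ℚ) / (q : ℚ) - (n : ℚ) - (α' : ℚ) / (γ' : ℚ)| <
      1 / ((Int.gcd α γ : ℚ) * |(γ' : ℚ)|)) :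
    ((((((δ - n * γ) * p - (β + n * δ - n * (α + n * γ)) * q : ℤ) : ℚ) /
        (((α + n * γ) * q - γ * p : ℤ) : ℚ)).den : ℤ)) < q := by
  have hk : (Int.gcd α γ : ℤ) ≠ 0 := by
    intro h
    rw [h, zero_mul] at hγ2
    exact hγ hγ2
  have hγ' : γ' ≠ 0 := by
    rintro rfl
    exact hγ (by rw [hγ2, mul_zero])
  have hD : (α + n * γ) * q - γ * p ≠ 0 := fun h => hne (by linarith)
  have hγQ : (γ : ℚ) = (Int.gcd α γ : ℚ) * γ' := by exact_mod_cast hγ2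
  have hαQ : (α : ℚ) = (Int.gcd α γ : ℚ) * α' := by exact_mod_cast hα
  have hkQ : (0 : ℚ) < (Int.gcd α γ : ℚ) := by
    have : Int.gcd α γ ≠ 0 := by exact_mod_cast hk
    exact_mod_cast Nat.pos_of_ne_zero this
  have hγQ' : (γ' : ℚ) ≠ 0 := by exact_mod_cast hγ'
  have hqQ : (0 : ℚ) < q := by exact_mod_cast hq
  generalize (Int.gcd α γ : ℚ) = k at hint hγQ hαQ hkQ
  have hc : 0 < k * |(γ' : ℚ)| := mul_pos hkQ (abs_pos.mpr hγQ')
  have hEq : |(((α + n * γ) * q - γ * p : ℤ) : ℚ)| =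
      k * |(γ' : ℚ)| * q * |(p : ℚ) / q - n - (α' : ℚ) / γ'| := by
    have hfac : (((α + n * γ) * q - γ * p : ℤ) : ℚ) =
        -(k * γ' * q * ((p : ℚ) / q - n - (α' : ℚ) / γ')) := by
      push_cast
      rw [hγQ, hαQ]
      field_simp
      ring
    rw [hfac, abs_neg, abs_mul, abs_mul, abs_mul, abs_of_pos hkQ, abs_of_pos hqQ]
  have hlt : |(α + n * γ) * q - γ * p| < q := by
    have : |(((α + n * γ) * q - γ * p : ℤ) : ℚ)| < q := by
      rw [hEq]
      rw [lt_div_iff₀ hc] at hint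
      nlinarith
    exact_mod_cast this
  refine lt_of_le_of_lt (Int.le_of_dvd (abs_pos.mpr hD) ?_) hlt
  rw [dvd_abs, ← Rat.divInt_eq_div]
  exact Rat.den_dvd _ _
end

section
/- Let Γ be a subgroup of GL(2,ℚ) acting on the projective line ℙ¹(ℚ), and suppose [[1,L],[0,1]] ∈ Γ for some positive integer L. Suppose there exist finitely many elements g₁, …, g_t ∈ Γ such that each g_i is a nonzero rational scalar multiple of an integer matrix M_i = [[α_i, β_i],[γ_i, δ_i]] with gcd(α_i, β_i, γ_i, δ_i) = 1 and γ_i ≠ 0, and, writing k_i = gcd(α_i, γ_i), α_i = k_i·α_i', γ_i = k_i·γ_i', the open intervals (α_i'/γ_i' − 1/(k_i·|γ_i'|), α_i'/γ_i' + 1/(k_i·|γ_i'|)) for i = 1, …, t cover the interval [0, L] ∩ ℚ. Then the Γ-orbit of the point ∞ = [1:0] is all of ℙ¹(ℚ). -/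
open Matrix

/-- The nonzero multiples of the vectors `u • ![1, 0]` with `u ∈ Γ`, i.e. the vectors whose class
in the projective line lies in the `Γ`-orbit of `∞`. -/
def MemInftyOrbit (Γ : Subgroup (GeneralLinearGroup (Fin 2) ℚ)) (v : Fin 2 → ℚ) : Prop :=
  ∃ u ∈ Γ, ∃ r : ℚ, r ≠ 0 ∧ (u.val : Matrix (Fin 2) (Fin 2) ℚ) *ᵥ ![1, 0] = r • v

theorem MemInftyOrbit.mulVec {Γ : Subgroup (GeneralLinearGroup (Fin 2) ℚ)} {v : Fin 2 → ℚ}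
    (hv : MemInftyOrbit Γ v) {w : GeneralLinearGroup (Fin 2) ℚ} (hw : w ∈ Γ) :
    MemInftyOrbit Γ ((w.val : Matrix (Fin 2) (Fin 2) ℚ) *ᵥ v) := by
  obtain ⟨u, hu, r, hr, h⟩ := hv
  refine ⟨w * u, Γ.mul_mem hw hu, r, hr, ?_⟩
  rw [Units.val_mul, ← mulVec_mulVec, h, mulVec_smul]

theorem MemInftyOrbit.of_smul {Γ : Subgroup (GeneralLinearGroup (Fin 2) ℚ)} {v : Fin 2 → ℚ}
    {s : ℚ} (hs : s ≠ 0) (hv : MemInftyOrbit Γ (s • v)) : MemInftyOrbit Γ v := by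
  obtain ⟨u, hu, r, hr, h⟩ := hv
  exact ⟨u, hu, r * s, mul_ne_zero hr hs, by rw [h, smul_smul]⟩

theorem Matrix.GeneralLinearGroup.val_zpow_of_eq_upperRight
    {u : GeneralLinearGroup (Fin 2) ℚ} {x : ℚ}
    (hu : (u.val : Matrix (Fin 2) (Fin 2) ℚ) = !![1, x; 0, 1]) (m : ℤ) :
    ((u ^ m).val : Matrix (Fin 2) (Fin 2) ℚ) = !![1, m * x; 0, 1] := by
  have h : u = GeneralLinearGroup.upperRightHom x := by
    apply Units.ext
    rw [hu]
    rfl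
  rw [h, ← AddChar.map_zsmul_eq_zpow, zsmul_eq_mul]
  rfl

/-- Applying the inverse of a matrix to a point of its killer interval lowers the denominator. -/
theorem natAbs_lt_of_mem_killerInterval {α γ α' γ' k p q : ℤ} (hγ : γ ≠ 0) (hk : 0 ≤ k)
    (hα' : α = k * α') (hγ' : γ = k * γ') (hq : q ≠ 0)
    (h : |(p : ℚ) / q - (α' : ℚ) / γ'| < 1 / ((k : ℚ) * |(γ' : ℚ)|)) :
    (α * q - γ * p).natAbs < q.natAbs := by
  have hk0 : k ≠ 0 := by rintro rfl; simp_all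
  have hγ0 : γ' ≠ 0 := by rintro rfl; simp_all
  have hkQ : (0 : ℚ) < k := by exact_mod_cast lt_of_le_of_ne hk hk0.symm
  have hqQ : (q : ℚ) ≠ 0 := by exact_mod_cast hq
  have hγQ : (γ' : ℚ) ≠ 0 := by exact_mod_cast hγ0
  have hpos : 0 < (k : ℚ) * |(γ' : ℚ)| := mul_pos hkQ (abs_pos.mpr hγQ)
  rw [lt_div_iff₀ hpos] at h
  have key : |((α * q - γ * p : ℤ) : ℚ)| =
      |(p : ℚ) / q - (α' : ℚ) / γ'| * ((k : ℚ) * |(γ' : ℚ)|) * |(q : ℚ)| := by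
    nth_rewrite 1 [← abs_of_pos hkQ]
    rw [← abs_mul, ← abs_mul, ← abs_mul, abs_eq_abs]
    right
    subst hα' hγ'
    push_cast
    field_simp
    ring
  have : |((α * q - γ * p : ℤ) : ℚ)| < |(q : ℚ)| := by
    rw [key]
    exact mul_lt_of_lt_one_left (abs_pos.mpr hqQ) h
  rw [Int.natAbs_lt_iff_sq_lt, sq_lt_sq]
  exact_mod_cast this

/-- **Long–Reid Theorem 2.5.** Let `Γ ≤ GL(2,ℚ)` contain the translation matrix
`[[1,L],[0,1]]` for a positive integer `L`.  Suppose there are finitely many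
elements `g 0, …, g (t-1) ∈ Γ`, each a nonzero rational multiple `c i` of an
integer matrix `[[α i, β i],[γ i, δ i]]` with content one and `γ i ≠ 0`, such that,
writing `k i = gcd (α i) (γ i)`, `α i = k i * α' i`, `γ i = k i * γ' i`, the killer
intervals `(α' i/γ' i - 1/(k i * |γ' i|), α' i/γ' i + 1/(k i * |γ' i|))` cover
`[0, L] ∩ ℚ`.  Then the `Γ`-orbit of `∞ = [1:0]` is all of `ℙ¹(ℚ)`. -/
theorem stmt_2 (Γ : Subgroup (Matrix.GeneralLinearGroup (Fin 2) ℚ))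
    (L : ℕ) (hL : 0 < L)
    (hT : ∃ u : Matrix.GeneralLinearGroup (Fin 2) ℚ, u ∈ Γ ∧
      (u.val : Matrix (Fin 2) (Fin 2) ℚ) = !![1, (L : ℚ); 0, 1])
    (t : ℕ) (g : Fin t → Matrix.GeneralLinearGroup (Fin 2) ℚ) (hg : ∀ i, g i ∈ Γ)
    (c : Fin t → ℚ) (hc : ∀ i, c i ≠ 0)
    (α β γ δ : Fin t → ℤ)
    (hmat : ∀ i, ((g i).val : Matrix (Fin 2) (Fin 2) ℚ) =
      c i • !![(α i : ℚ), (β i : ℚ); (γ i : ℚ), (δ i : ℚ)])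
    (hcontent : ∀ i, Int.gcd (Int.gcd (α i) (β i)) (Int.gcd (γ i) (δ i)) = 1)
    (hγ : ∀ i, γ i ≠ 0)
    (α' γ' : Fin t → ℤ)
    (hα' : ∀ i, α i = (Int.gcd (α i) (γ i) : ℤ) * α' i)
    (hγ' : ∀ i, γ i = (Int.gcd (α i) (γ i) : ℤ) * γ' i)
    (hcover : ∀ x : ℚ, 0 ≤ x → x ≤ (L : ℚ) →
      ∃ i, |x - (α' i : ℚ) / (γ' i : ℚ)| <
        1 / ((Int.gcd (α i) (γ i) : ℚ) * |(γ' i : ℚ)|)) :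
    ∀ P : Projectivization ℚ (Fin 2 → ℚ),
      ∃ u : Matrix.GeneralLinearGroup (Fin 2) ℚ, u ∈ Γ ∧
        ∃ h : (u.val : Matrix (Fin 2) (Fin 2) ℚ).mulVec ![1, 0] ≠ 0,
          Projectivization.mk ℚ ((u.val : Matrix (Fin 2) (Fin 2) ℚ).mulVec ![1, 0]) h = P := by
  obtain ⟨T, hTΓ, hTval⟩ := hT
  have orbit : ∀ (n : ℕ) (p q : ℤ), q.natAbs = n → (p ≠ 0 ∨ q ≠ 0) →
      MemInftyOrbit Γ ![(p : ℚ), (q : ℚ)] := by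
    intro n
    induction n using Nat.strong_induction_on with
    | _ n ih =>
    intro p q hn hpq
    by_cases hq : q = 0
    · subst hq
      have hp : (p : ℚ) ≠ 0 := by simpa using hpq
      refine ⟨1, Γ.one_mem, (p : ℚ)⁻¹, inv_ne_zero hp, ?_⟩
      simp [hp]
    have hqQ : (q : ℚ) ≠ 0 := by exact_mod_cast hq
    have hLQ : (0 : ℚ) < L := by exact_mod_cast hL
    set m : ℤ := ⌊(p : ℚ) / q / L⌋ with hm
    set p₁ : ℤ := p - m * L * q with hp₁
    have hx : (p₁ : ℚ) / q = p / q - m * L := by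
      rw [hp₁]
      push_cast
      field_simp
    have hx0 : (0 : ℚ) ≤ (p₁ : ℚ) / q := by
      rw [hx, sub_nonneg, ← le_div_iff₀ hLQ]
      exact Int.floor_le _
    have hxL : (p₁ : ℚ) / q ≤ L := by
      have := (div_lt_iff₀ hLQ).mp (Int.lt_floor_add_one ((p : ℚ) / q / L))
      rw [← hm] at this
      rw [hx]
      linarith
    obtain ⟨i, hi⟩ := hcover _ hx0 hxL
    have hlt := natAbs_lt_of_mem_killerInterval (hγ i) (Int.natCast_nonneg _) (hα' i) (hγ' i) hq
      (by exact_mod_cast hi)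
    have hdet : (α i * δ i - β i * γ i : ℚ) ≠ 0 := by
      intro h0
      have hdet_unit := ((isUnit_iff_isUnit_det _).mp (g i).isUnit).ne_zero
      rw [hmat i, det_smul, det_fin_two_of, h0, mul_zero] at hdet_unit
      exact hdet_unit rfl
    have hne : δ i * p₁ - β i * q ≠ 0 ∨ α i * q - γ i * p₁ ≠ 0 := by
      by_contra! hcon
      have h1 : ((δ i : ℚ) * p₁ - β i * q) = 0 := by exact_mod_cast hcon.1
      have h2 : ((α i : ℚ) * q - γ i * p₁) = 0 := by exact_mod_cast hcon.2
      refine mul_ne_zero hdet hqQ ?_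
      linear_combination (γ i : ℚ) * h1 + (δ i : ℚ) * h2
    have hstep := ((ih _ (hn ▸ hlt) _ _ rfl hne).mulVec (hg i)).mulVec (Γ.zpow_mem hTΓ m)
    refine MemInftyOrbit.of_smul (mul_ne_zero (hc i) hdet) ?_
    convert hstep using 1
    rw [hmat i, GeneralLinearGroup.val_zpow_of_eq_upperRight hTval]
    ext j
    fin_cases j <;>
      simp [mulVec, dotProduct, Fin.sum_univ_two, hp₁] <;>
      ring
  intro P
  induction P using Projectivization.ind with
  | h v hv =>
  have hscale : ((v 0).den * (v 1).den : ℚ) • v =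
      ![(((v 0).num * (v 1).den : ℤ) : ℚ), (((v 1).num * (v 0).den : ℤ) : ℚ)] := by
    ext j
    fin_cases j
    · simp only [Fin.zero_eta, Pi.smul_apply, smul_eq_mul, cons_val_zero]
      push_cast
      linear_combination ((v 1).den : ℚ) * Rat.den_mul_eq_num (v 0)
    · simp only [Fin.mk_one, Pi.smul_apply, smul_eq_mul, cons_val_one]
      push_cast
      linear_combination ((v 0).den : ℚ) * Rat.den_mul_eq_num (v 1)
  have hnum : (v 0).num * (v 1).den ≠ 0 ∨ (v 1).num * (v 0).den ≠ 0 := by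
    by_contra! hcon
    refine hv (funext fun j => ?_)
    fin_cases j
    · simpa using hcon.1
    · simpa using hcon.2
  have hmem : MemInftyOrbit Γ v :=
    MemInftyOrbit.of_smul (s := (v 0).den * (v 1).den) (by simp)
      (hscale ▸ orbit _ _ _ rfl hnum)
  obtain ⟨u, hu, r, hr, h⟩ := hmem
  have h0 : (u.val : Matrix (Fin 2) (Fin 2) ℚ) *ᵥ ![1, 0] ≠ 0 := h ▸ smul_ne_zero hr hv
  exact ⟨u, hu, h0, (Projectivization.mk_eq_mk_iff' ℚ _ _ h0 hv).mpr ⟨r, h.symm⟩⟩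
end

section
/- Let k₁, k₂, k₃ > 0 be real numbers and let ι₁ = (1/√k₁)·[[k₁, 1+k₁],[−k₁, −k₁]], ι₂ = (1/√k₂)·[[1, 1],[−(k₂+1), −1]], ι₃ = (1/√k₃)·[[0, k₃],[−1, 0]] in SL(2,ℝ). Then the product satisfies ι₁·ι₂·ι₃ = (1/√(k₁k₂k₃))·[[1, k₃·(k₁ − (1+k₁)(1+k₂))],[0, k₁k₂k₃]]; its trace is (1 + k₁k₂k₃)/√(k₁k₂k₃) ≥ 2, with equality if and only if k₁k₂k₃ = 1. In particular, ι₁·ι₂·ι₃ is parabolic (trace 2 and not equal to ±I, since the upper-right entry k₃·(k₁ − (1+k₁)(1+k₂)) is negative) if and only if k₁k₂k₃ = 1. -/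
/-- The π-rotation `ι₁(k)` of the marked ideal triangle in standard position. -/
noncomputable def iota1 (k : ℝ) : Matrix (Fin 2) (Fin 2) ℝ :=
  (1 / Real.sqrt k) • !![k, 1 + k; -k, -k]

/-- The π-rotation `ι₂(k)`. -/
noncomputable def iota2 (k : ℝ) : Matrix (Fin 2) (Fin 2) ℝ :=
  (1 / Real.sqrt k) • !![1, 1; -(k + 1), -1]

/-- The π-rotation `ι₃(k)`. -/
noncomputable def iota3 (k : ℝ) : Matrix (Fin 2) (Fin 2) ℝ :=
  (1 / Real.sqrt k) • !![0, k; -1, 0]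

theorem iota1_mul_iota2_mul_iota3 (k₁ k₂ k₃ : ℝ) (h₁ : 0 ≤ k₁) (h₂ : 0 ≤ k₂) :
    iota1 k₁ * iota2 k₂ * iota3 k₃ =
      (1 / Real.sqrt (k₁ * k₂ * k₃)) •
        !![1, k₃ * (k₁ - (1 + k₁) * (1 + k₂)); 0, k₁ * k₂ * k₃] := by
  have hs : 1 / √(k₁ * k₂ * k₃) = 1 / √k₃ * (1 / √k₁ * (1 / √k₂)) := by
    rw [Real.sqrt_mul (mul_nonneg h₁ h₂), Real.sqrt_mul h₁]
    ring
  simp only [iota1, iota2, iota3, smul_mul_assoc, mul_smul_comm, smul_smul, hs,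
    Matrix.mul_fin_two]
  congr 1
  · ring
  · ext i j
    fin_cases i <;> fin_cases j <;> simp [-mul_eq_mul_left_iff, -mul_eq_mul_right_iff] <;> ring

theorem two_le_one_add_div_sqrt {p : ℝ} (hp : 0 < p) : 2 ≤ (1 + p) / √p := by
  rw [le_div_iff₀ (Real.sqrt_pos.2 hp)]
  nlinarith [sq_nonneg (√p - 1), Real.sq_sqrt hp.le]

theorem one_add_div_sqrt_eq_two_iff {p : ℝ} (hp : 0 < p) : (1 + p) / √p = 2 ↔ p = 1 := by
  rw [div_eq_iff (Real.sqrt_pos.2 hp).ne']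
  refine ⟨fun h => ?_, fun h => by subst h; norm_num⟩
  have hsq : (√p - 1) ^ 2 = 0 := by linear_combination Real.sq_sqrt hp.le + h
  exact Real.sqrt_eq_one.1 (sub_eq_zero.1 (pow_eq_zero_iff two_ne_zero |>.1 hsq))

/-- For `k₁, k₂, k₃ > 0` the product `ι₁ι₂ι₃` equals
`(1/√(k₁k₂k₃)) • [[1, k₃(k₁-(1+k₁)(1+k₂))],[0, k₁k₂k₃]]`, its trace is
`(1+k₁k₂k₃)/√(k₁k₂k₃) ≥ 2` with equality iff `k₁k₂k₃ = 1`; the upper-right entry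
`k₃(k₁-(1+k₁)(1+k₂))` is negative, and `ι₁ι₂ι₃` is parabolic (trace 2 and not `±I`)
iff `k₁k₂k₃ = 1`. -/
theorem stmt_4 (k₁ k₂ k₃ : ℝ) (h₁ : 0 < k₁) (h₂ : 0 < k₂) (h₃ : 0 < k₃) :
    iota1 k₁ * iota2 k₂ * iota3 k₃ =
      (1 / Real.sqrt (k₁ * k₂ * k₃)) •
        !![1, k₃ * (k₁ - (1 + k₁) * (1 + k₂)); 0, k₁ * k₂ * k₃] ∧
    (iota1 k₁ * iota2 k₂ * iota3 k₃).trace =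
      (1 + k₁ * k₂ * k₃) / Real.sqrt (k₁ * k₂ * k₃) ∧
    2 ≤ (iota1 k₁ * iota2 k₂ * iota3 k₃).trace ∧
    ((iota1 k₁ * iota2 k₂ * iota3 k₃).trace = 2 ↔ k₁ * k₂ * k₃ = 1) ∧
    k₃ * (k₁ - (1 + k₁) * (1 + k₂)) < 0 ∧
    (((iota1 k₁ * iota2 k₂ * iota3 k₃).trace = 2 ∧
        iota1 k₁ * iota2 k₂ * iota3 k₃ ≠ 1 ∧
        iota1 k₁ * iota2 k₂ * iota3 k₃ ≠ -1) ↔ k₁ * k₂ * k₃ = 1) := by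
  have hmul := iota1_mul_iota2_mul_iota3 k₁ k₂ k₃ h₁.le h₂.le
  have hp : 0 < k₁ * k₂ * k₃ := by positivity
  have htr : (iota1 k₁ * iota2 k₂ * iota3 k₃).trace =
      (1 + k₁ * k₂ * k₃) / √(k₁ * k₂ * k₃) := by
    rw [hmul, Matrix.trace_smul, Matrix.trace_fin_two_of, smul_eq_mul, one_div_mul_eq_div]
  have hiff : (iota1 k₁ * iota2 k₂ * iota3 k₃).trace = 2 ↔ k₁ * k₂ * k₃ = 1 := by
    rw [htr, one_add_div_sqrt_eq_two_iff hp]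
  have hneg : k₃ * (k₁ - (1 + k₁) * (1 + k₂)) < 0 :=
    mul_neg_of_pos_of_neg h₃ (by nlinarith [mul_pos h₁ h₂])
  have hentry : (iota1 k₁ * iota2 k₂ * iota3 k₃) 0 1 ≠ 0 := by
    rw [hmul]
    exact mul_ne_zero (one_div_pos.2 (Real.sqrt_pos.2 hp)).ne' hneg.ne
  refine ⟨hmul, htr, htr ▸ two_le_one_add_div_sqrt hp, hiff, hneg,
    fun h => hiff.1 h.1, fun h => ⟨hiff.2 h, fun h1 => hentry ?_, fun h1 => hentry ?_⟩⟩ <;>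
  simp [h1]
end

section
/- The subgroup of SL(2,ℤ) generated by the three matrices [[1, 2],[−1, −1]], [[1, 1],[−2, −1]], and [[0, 1],[−1, 0]] has index 3 in SL(2,ℤ). (This subgroup contains −I since [[0,1],[−1,0]]² = −I, so equivalently the Weierstrass group Γ(1,1,1) is an index-three subgroup of the modular group PSL(2,ℤ).) -/
/-- The generator `ι₁ = [[1,2],[-1,-1]]` of the Weierstrass group `Γ(1,1,1)`. -/
def j1 : Matrix.SpecialLinearGroup (Fin 2) ℤ :=
  ⟨!![1, 2; -1, -1], by norm_num [Matrix.det_fin_two_of]⟩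

/-- The generator `ι₂ = [[1,1],[-2,-1]]`. -/
def j2 : Matrix.SpecialLinearGroup (Fin 2) ℤ :=
  ⟨!![1, 1; -2, -1], by norm_num [Matrix.det_fin_two_of]⟩

/-- The generator `ι₃ = [[0,1],[-1,0]]`. -/
def j3 : Matrix.SpecialLinearGroup (Fin 2) ℤ :=
  ⟨!![0, 1; -1, 0], by norm_num [Matrix.det_fin_two_of]⟩

open ModularGroup in
theorem conj_T_mem_closure {g : Matrix.SpecialLinearGroup (Fin 2) ℤ}
    (hg : g ∈ Subgroup.closure {j1, j2, j3}) :
    T * g * T⁻¹ ∈ Subgroup.closure {j1, j2, j3} := by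
  have h1 : j1 ∈ Subgroup.closure {j1, j2, j3} := Subgroup.subset_closure (by simp)
  have h2 : j2 ∈ Subgroup.closure {j1, j2, j3} := Subgroup.subset_closure (by simp)
  have h3 : j3 ∈ Subgroup.closure {j1, j2, j3} := Subgroup.subset_closure (by simp)
  have hle : Subgroup.closure {j1, j2, j3} ≤
      (Subgroup.closure {j1, j2, j3}).comap (MulAut.conj T).toMonoidHom := by
    rw [Subgroup.closure_le]
    rintro x (rfl | rfl | rfl) <;>
      simp only [SetLike.mem_coe, Subgroup.mem_comap, MulEquiv.coe_toMonoidHom, MulAut.conj_apply]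
    · rwa [show T * j1 * T⁻¹ = j3 by decide]
    · rw [show T * j2 * T⁻¹ = j3 * j1 * j3⁻¹ by decide]
      exact mul_mem (mul_mem h3 h1) (inv_mem h3)
    · rw [show T * j3 * T⁻¹ = j3 * j2 * j3⁻¹ by decide]
      exact mul_mem (mul_mem h3 h2) (inv_mem h3)
  exact hle hg

open ModularGroup in
theorem T_pow_three_mem_closure : T ^ 3 ∈ Subgroup.closure {j1, j2, j3} := by
  rw [show T ^ 3 = (j1 * j2 * j3)⁻¹ by decide]
  exact inv_mem (mul_mem (mul_mem (Subgroup.subset_closure (by simp))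
    (Subgroup.subset_closure (by simp))) (Subgroup.subset_closure (by simp)))

open ModularGroup in
theorem closure_normal : (Subgroup.closure {j1, j2, j3}).Normal := by
  rw [← Subgroup.normalizer_eq_top_iff, eq_top_iff,
    ← SpecialLinearGroup.SL2Z_generators, Subgroup.closure_le]
  rintro x (rfl | rfl)
  · refine Subgroup.le_normalizer ?_
    rw [show S = j3⁻¹ by decide]
    exact inv_mem (Subgroup.subset_closure (by simp))
  · refine Subgroup.mem_normalizer_iff.2 fun g => ⟨conj_T_mem_closure, fun hg => ?_⟩
    have h := conj_T_mem_closure (conj_T_mem_closure hg)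
    have h3 := T_pow_three_mem_closure
    have := mul_mem (mul_mem (inv_mem h3) h) h3
    convert this using 1
    group

/-- The elements of the quaternion subgroup of `SL(2, 𝔽₃)` are `±1` and the matrices of
trace zero. -/
theorem trace_or_scalar_mod_three {g : Matrix.SpecialLinearGroup (Fin 2) ℤ}
    (hg : g ∈ Subgroup.closure {j1, j2, j3}) :
    ((g 0 0 : ZMod 3) + g 1 1 = 0) ∨
      ((g 0 0 : ZMod 3) = g 1 1 ∧ (g 0 1 : ZMod 3) = 0 ∧ (g 1 0 : ZMod 3) = 0) := by
  have hdet (x : Matrix.SpecialLinearGroup (Fin 2) ℤ) :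
      (x 0 0 : ZMod 3) * x 1 1 - x 0 1 * x 1 0 = 1 := by
    have := x.det_coe
    rw [Matrix.det_fin_two] at this
    exact_mod_cast congrArg (Int.cast : ℤ → ZMod 3) this
  induction hg using Subgroup.closure_induction_left with
  | one => right; simp
  | mul_left x hx y hy ih =>
    have hd := hdet y
    rcases hx with rfl | rfl | rfl <;>
      simp only [Matrix.SpecialLinearGroup.coe_mul, Matrix.mul_apply, Fin.sum_univ_two,
        Int.cast_add, Int.cast_mul] <;>
      generalize (y 0 0 : ZMod 3) = a, (y 0 1 : ZMod 3) = b, (y 1 0 : ZMod 3) = c,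
        (y 1 1 : ZMod 3) = d at * <;>
      revert a b c d <;> decide
  | inv_mul_cancel x hx y hy ih =>
    have hd := hdet y
    rcases hx with rfl | rfl | rfl <;>
      simp only [Matrix.SpecialLinearGroup.coe_mul, Matrix.mul_apply, Fin.sum_univ_two,
        Int.cast_add, Int.cast_mul] <;>
      generalize (y 0 0 : ZMod 3) = a, (y 0 1 : ZMod 3) = b, (y 1 0 : ZMod 3) = c,
        (y 1 1 : ZMod 3) = d at * <;>
      revert a b c d <;> decide

open ModularGroup in
theorem T_notMem_closure : T ∉ Subgroup.closure {j1, j2, j3} := fun h => by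
  have := trace_or_scalar_mod_three h
  revert this
  decide

/-- The Weierstrass group `Γ(1,1,1)`, i.e. the subgroup of `SL(2,ℤ)` generated by
`[[1,2],[-1,-1]]`, `[[1,1],[-2,-1]]` and `[[0,1],[-1,0]]`, has index 3 in `SL(2,ℤ)`;
moreover it contains `-I` since `[[0,1],[-1,0]]² = -I`. -/
theorem stmt_6 :
    ((j3 * j3 : Matrix.SpecialLinearGroup (Fin 2) ℤ) : Matrix (Fin 2) (Fin 2) ℤ) = -1 ∧
    (Subgroup.closure ({j1, j2, j3} : Set (Matrix.SpecialLinearGroup (Fin 2) ℤ))).index = 3 := by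
  refine ⟨by decide, ?_⟩
  have hn := closure_normal
  have hT : orderOf (QuotientGroup.mk' (Subgroup.closure {j1, j2, j3}) ModularGroup.T) = 3 := by
    have : Fact (Nat.Prime 3) := ⟨Nat.prime_three⟩
    refine orderOf_eq_prime ?_ ?_
    · rw [← map_pow]
      exact (QuotientGroup.eq_one_iff _).2 T_pow_three_mem_closure
    · exact fun h => T_notMem_closure ((QuotientGroup.eq_one_iff _).1 h)
  have htop : Subgroup.zpowers
      (QuotientGroup.mk' (Subgroup.closure {j1, j2, j3}) ModularGroup.T) = ⊤ := by
    rw [eq_top_iff, ← Subgroup.map_top_of_surjective _ (QuotientGroup.mk'_surjective _),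
      ← SpecialLinearGroup.SL2Z_generators, Subgroup.map_le_iff_le_comap,
      Subgroup.closure_le]
    rintro x (rfl | rfl)
    · have hS : ModularGroup.S ∈ Subgroup.closure {j1, j2, j3} := by
        rw [show ModularGroup.S = j3⁻¹ by decide]
        exact inv_mem (Subgroup.subset_closure (by simp))
      have : QuotientGroup.mk' (Subgroup.closure {j1, j2, j3}) ModularGroup.S = 1 :=
        (QuotientGroup.eq_one_iff _).2 hS
      simp only [SetLike.mem_coe, Subgroup.mem_comap, this, one_mem]
    · exact Subgroup.mem_zpowers _
  rw [Subgroup.index, ← hT, ← Nat.card_zpowers, htop, Subgroup.card_top]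
end

section
/- Let Γ be the subgroup of GL(2,ℚ) generated by the three matrices M₁ = [[1, 2],[−1, −1]], M₂ = [[3, 3],[−4, −3]], M₃ = [[0, 3],[−1, 0]] (which represent, as projective transformations, the standard-position generators of the Weierstrass group Γ(1, 1/3, 3)). Then every point of the projective line ℙ¹(ℚ) lies either in the Γ-orbit of the point ∞ = [1:0] or in the Γ-orbit of the point [1:1] (the rational number 1). That is, every rational number is either a cusp of Γ(1,1/3,3) or is Γ-equivalent to the special point 1. -/
/-- The standard-position generators of the Weierstrass group `Γ(1,1/3,3)` viewed as
elements of `GL(2,ℚ)` (as projective transformations). -/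
noncomputable def g1 : Matrix.GeneralLinearGroup (Fin 2) ℚ :=
  Matrix.GeneralLinearGroup.mkOfDetNeZero !![1, 2; -1, -1]
    (by norm_num [Matrix.det_fin_two_of])

noncomputable def g2 : Matrix.GeneralLinearGroup (Fin 2) ℚ :=
  Matrix.GeneralLinearGroup.mkOfDetNeZero !![3, 3; -4, -3]
    (by norm_num [Matrix.det_fin_two_of])

noncomputable def g3 : Matrix.GeneralLinearGroup (Fin 2) ℚ :=
  Matrix.GeneralLinearGroup.mkOfDetNeZero !![0, 3; -1, 0]
    (by norm_num [Matrix.det_fin_two_of])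

open Matrix

/-- The line spanned by `v` lies in the `Γ`-orbit of `[1:0]` or of `[1:1]`. -/
def InCuspOrSpecialOrbit (v : Fin 2 → ℚ) : Prop :=
  ∃ u ∈ Subgroup.closure ({g1, g2, g3} : Set (GeneralLinearGroup (Fin 2) ℚ)),
    ∃ c : ℚ, c ≠ 0 ∧ (u.val *ᵥ ![1, 0] = c • v ∨ u.val *ᵥ ![1, 1] = c • v)

namespace InCuspOrSpecialOrbit

theorem smul_iff {v : Fin 2 → ℚ} {a : ℚ} (ha : a ≠ 0) :
    InCuspOrSpecialOrbit (a • v) ↔ InCuspOrSpecialOrbit v := by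
  constructor
  · rintro ⟨u, hu, c, hc, h⟩
    exact ⟨u, hu, c * a, mul_ne_zero hc ha, by simpa [smul_smul] using h⟩
  · rintro ⟨u, hu, c, hc, h⟩
    refine ⟨u, hu, c * a⁻¹, mul_ne_zero hc (inv_ne_zero ha), ?_⟩
    simpa [smul_smul, mul_assoc, ha] using h

theorem mulVec {v : Fin 2 → ℚ} (h : InCuspOrSpecialOrbit v)
    {s : GeneralLinearGroup (Fin 2) ℚ}
    (hs : s ∈ Subgroup.closure ({g1, g2, g3} : Set (GeneralLinearGroup (Fin 2) ℚ))) :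
    InCuspOrSpecialOrbit (s.val *ᵥ v) := by
  obtain ⟨u, hu, c, hc, h⟩ := h
  refine ⟨s * u, mul_mem hs hu, c, hc, ?_⟩
  rw [Units.val_mul, ← mulVec_mulVec, ← mulVec_mulVec, ← mulVec_smul]
  exact h.imp (congrArg _) (congrArg _)

theorem mulVec_iff {v : Fin 2 → ℚ} {s : GeneralLinearGroup (Fin 2) ℚ}
    (hs : s ∈ Subgroup.closure ({g1, g2, g3} : Set (GeneralLinearGroup (Fin 2) ℚ))) :
    InCuspOrSpecialOrbit (s.val *ᵥ v) ↔ InCuspOrSpecialOrbit v := by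
  refine ⟨fun h => ?_, fun h => h.mulVec hs⟩
  have h' := h.mulVec (inv_mem hs)
  rwa [mulVec_mulVec, ← Units.val_mul, inv_mul_cancel, Units.val_one, one_mulVec] at h'

theorem g1_iff (p q : ℚ) :
    InCuspOrSpecialOrbit ![p + 2 * q, -p - q] ↔ InCuspOrSpecialOrbit ![p, q] := by
  have h : g1.val *ᵥ ![p, q] = ![p + 2 * q, -p - q] := by
    change !![1, 2; -1, -1] *ᵥ ![p, q] = _
    rw [mulVec_fin_two]
    simp [sub_eq_add_neg]
  rw [← h]
  exact mulVec_iff (Subgroup.subset_closure (by simp))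

theorem g2_iff (p q : ℚ) :
    InCuspOrSpecialOrbit ![3 * p + 3 * q, -4 * p - 3 * q] ↔ InCuspOrSpecialOrbit ![p, q] := by
  have h : g2.val *ᵥ ![p, q] = ![3 * p + 3 * q, -4 * p - 3 * q] := by
    change !![3, 3; -4, -3] *ᵥ ![p, q] = _
    rw [mulVec_fin_two]
    simp [sub_eq_add_neg]
  rw [← h]
  exact mulVec_iff (Subgroup.subset_closure (by simp))

theorem g3_iff (p q : ℚ) :
    InCuspOrSpecialOrbit ![3 * q, -p] ↔ InCuspOrSpecialOrbit ![p, q] := by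
  have h : g3.val *ᵥ ![p, q] = ![3 * q, -p] := by
    change !![0, 3; -1, 0] *ᵥ ![p, q] = _
    rw [mulVec_fin_two]
    simp
  rw [← h]
  exact mulVec_iff (Subgroup.subset_closure (by simp))

theorem smul_vec_iff {a : ℚ} (ha : a ≠ 0) (p q : ℚ) :
    InCuspOrSpecialOrbit ![a * p, a * q] ↔ InCuspOrSpecialOrbit ![p, q] := by
  rw [← smul_iff (v := ![p, q]) ha]
  simp

theorem sub_five_iff (p q : ℚ) :
    InCuspOrSpecialOrbit ![p - 5 * q, q] ↔ InCuspOrSpecialOrbit ![p, q] := by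
  rw [← g3_iff p q, ← g2_iff (3 * q), ← g1_iff (3 * (3 * q) + _),
    ← smul_vec_iff (a := 3) (by norm_num) (p - 5 * q)]
  ring_nf

theorem sub_five_mul_iff (p q : ℚ) (k : ℤ) :
    InCuspOrSpecialOrbit ![p - 5 * q * k, q] ↔ InCuspOrSpecialOrbit ![p, q] := by
  induction k with
  | zero => simp
  | succ k ih =>
    rw [← ih, ← sub_five_iff (p - 5 * q * ((k : ℤ) : ℚ))]
    push_cast
    ring_nf
  | pred k ih =>
    rw [← ih, ← sub_five_iff (p - 5 * q * ((-(k : ℤ) - 1 : ℤ) : ℚ))]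
    push_cast
    ring_nf

theorem one_zero : InCuspOrSpecialOrbit ![1, 0] :=
  ⟨1, one_mem _, 1, one_ne_zero, by simp⟩

theorem one_one : InCuspOrSpecialOrbit ![1, 1] :=
  ⟨1, one_mem _, 1, one_ne_zero, by simp⟩

theorem two_one : InCuspOrSpecialOrbit ![2, 1] := by
  rw [← smul_vec_iff (a := -3) (by norm_num)]
  have h := one_one
  rw [← g1_iff, ← g3_iff] at h
  norm_num at h ⊢
  exact h

theorem intCast_of_natAbs_lt (n : ℕ) :
    ∀ p q : ℤ, q.natAbs < n → (p ≠ 0 ∨ q ≠ 0) → InCuspOrSpecialOrbit ![(p : ℚ), q] := by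
  induction n with
  | zero => intro p q h; omega
  | succ n ih =>
    have hpos : ∀ p q : ℤ, q.natAbs < n + 1 → 0 < q → InCuspOrSpecialOrbit ![(p : ℚ), q] := by
      intro p q hq h0
      have hq0 : (q : ℚ) ≠ 0 := by exact_mod_cast h0.ne'
      rw [← sub_five_mul_iff _ _ ((p + q) / (5 * q))]
      obtain ⟨r, hr⟩ : ∃ r, r = p - 5 * q * ((p + q) / (5 * q)) := ⟨_, rfl⟩
      have hr1 : -q ≤ r := by
        have := Int.emod_nonneg (p + q) (b := 5 * q) (by omega)
        rw [Int.emod_def] at this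
        omega
      have hr2 : r < 4 * q := by
        have := Int.emod_lt_of_pos (p + q) (b := 5 * q) (by omega)
        rw [Int.emod_def] at this
        omega
      have hrq : (p : ℚ) - 5 * q * ((p + q) / (5 * q) : ℤ) = r := by rw [hr]; push_cast; rfl
      rw [hrq]
      rcases lt_or_ge r 0 with h | h
      · rw [← g1_iff]
        exact_mod_cast ih (r + 2 * q) (-r - q) (by omega) (by omega)
      rcases lt_trichotomy r q with h | rfl | h
      · rw [← g3_iff]
        exact_mod_cast ih (3 * q) (-r) (by omega) (by omega)
      · simpa using (smul_vec_iff hq0 1 1).2 one_one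
      rcases lt_trichotomy r (2 * q) with h | rfl | h
      · rw [← g3_iff, ← g1_iff, ← g3_iff]
        have := ih (3 * (r - 3 * q)) (2 * r - 3 * q) (by omega) (by omega)
        push_cast at this
        convert this using 3 <;> ring
      · simpa [mul_comm] using (smul_vec_iff hq0 2 1).2 two_one
      · rw [← g3_iff, ← g1_iff]
        have := ih (3 * q - 2 * r) (r - 3 * q) (by omega) (by omega)
        push_cast at this
        convert this using 3 <;> ring
    intro p q hq hpq
    rcases lt_trichotomy q 0 with h | rfl | h
    · rw [← smul_vec_iff (a := -1) (by norm_num)]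
      simpa using hpos (-p) (-q) (by omega) (by omega)
    · have hp : (p : ℚ) ≠ 0 := by exact_mod_cast hpq.resolve_right (by simp)
      simpa using (smul_vec_iff hp 1 0).2 one_zero
    · exact hpos p q hq h

theorem of_ne_zero {v : Fin 2 → ℚ} (hv : v ≠ 0) : InCuspOrSpecialOrbit v := by
  have hd0 : ((v 0).den : ℚ) ≠ 0 := by exact_mod_cast (v 0).den_nz
  have hd1 : ((v 1).den : ℚ) ≠ 0 := by exact_mod_cast (v 1).den_nz
  have h0 : (v 0).den * v 0 = (v 0).num := Rat.den_mul_eq_num _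
  have h1 : (v 1).den * v 1 = (v 1).num := Rat.den_mul_eq_num _
  have hne : (v 0).num * (v 1).den ≠ 0 ∨ (v 1).num * (v 0).den ≠ 0 := by
    by_contra! h
    apply hv
    ext i
    fin_cases i
    · simpa using h.1
    · simpa using h.2
  rw [← smul_iff (mul_ne_zero hd0 hd1)]
  convert intCast_of_natAbs_lt _ _ _ (Nat.lt_succ_self _) hne using 1
  ext i
  fin_cases i
  · simp only [Fin.zero_eta, Pi.smul_apply, smul_eq_mul, cons_val_zero]
    push_cast
    rw [← h0]
    ring
  · simp only [Fin.mk_one, Pi.smul_apply, smul_eq_mul, cons_val_one, cons_val_zero]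
    push_cast
    rw [← h1]
    ring

end InCuspOrSpecialOrbit

/-- Every point of `ℙ¹(ℚ)` lies either in the orbit of `∞ = [1:0]` or in the orbit of
`[1:1]` (the rational number `1`) under the subgroup of `GL(2,ℚ)` generated by
`[[1,2],[-1,-1]]`, `[[3,3],[-4,-3]]`, `[[0,3],[-1,0]]`: every rational is either a
cusp of `Γ(1,1/3,3)` or equivalent to the special `1`. -/
theorem stmt_10 :
    ∀ P : Projectivization ℚ (Fin 2 → ℚ),
      (∃ u : Matrix.GeneralLinearGroup (Fin 2) ℚ,
          u ∈ Subgroup.closure ({g1, g2, g3} : Set (Matrix.GeneralLinearGroup (Fin 2) ℚ)) ∧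
          ∃ h : (u.val : Matrix (Fin 2) (Fin 2) ℚ).mulVec ![1, 0] ≠ 0,
            Projectivization.mk ℚ ((u.val : Matrix (Fin 2) (Fin 2) ℚ).mulVec ![1, 0]) h = P) ∨
      (∃ u : Matrix.GeneralLinearGroup (Fin 2) ℚ,
          u ∈ Subgroup.closure ({g1, g2, g3} : Set (Matrix.GeneralLinearGroup (Fin 2) ℚ)) ∧
          ∃ h : (u.val : Matrix (Fin 2) (Fin 2) ℚ).mulVec ![1, 1] ≠ 0,
            Projectivization.mk ℚ ((u.val : Matrix (Fin 2) (Fin 2) ℚ).mulVec ![1, 1]) h = P) := by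
  intro P
  induction P using Projectivization.ind with
  | h v hv =>
    obtain ⟨u, hu, c, hc, h⟩ := InCuspOrSpecialOrbit.of_ne_zero hv
    have hne : c • v ≠ 0 := smul_ne_zero hc hv
    have hmk : Projectivization.mk ℚ (c • v) hne = Projectivization.mk ℚ v hv :=
      (Projectivization.mk_eq_mk_iff' ℚ _ _ hne hv).2 ⟨c, rfl⟩
    refine h.imp (fun h => ⟨u, hu, ?_⟩) fun h => ⟨u, hu, ?_⟩
    all_goals
      rw [h]
      exact ⟨hne, hmk⟩
end

section
/- For integers a and b, let h₂(a) = (1/√2)·[[a, −(a²+2)],[1, −a]] and h₁(b) = [[b, −(b²+1)],[1, −b]] in SL(2,ℝ). Then (tr(h₂(a)·h₁(b)))² = ((a−b)² + 3)²/2, and this real number is an integer if and only if a − b is odd. -/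
/-- The π-rotation about the marked point at height `√2` on the vertical side `[∞, a]`
of type 2. -/
noncomputable def h2 (a : ℤ) : Matrix (Fin 2) (Fin 2) ℝ :=
  (1 / Real.sqrt 2) • !![(a : ℝ), -((a : ℝ) ^ 2 + 2); 1, -(a : ℝ)]

/-- The π-rotation about the marked point at height `1` on the vertical side `[∞, b]`
of type 1. -/
noncomputable def h1 (b : ℤ) : Matrix (Fin 2) (Fin 2) ℝ :=
  !![(b : ℝ), -((b : ℝ) ^ 2 + 1); 1, -(b : ℝ)]

/-- For integers `a, b`, `(tr(h₂(a)·h₁(b)))² = ((a-b)² + 3)²/2`, and this real number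
is an integer if and only if `a - b` is odd. -/
theorem stmt_14 (a b : ℤ) :
    ((h2 a * h1 b).trace) ^ 2 = (((a : ℝ) - b) ^ 2 + 3) ^ 2 / 2 ∧
    ((∃ z : ℤ, (((a : ℝ) - b) ^ 2 + 3) ^ 2 / 2 = (z : ℝ)) ↔ Odd (a - b)) := by
  constructor
  · have trace_eq : (h2 a * h1 b).trace = (1 / Real.sqrt 2) * -(((a : ℝ) - b) ^ 2 + 3) := by
      simp only [h2, h1, Matrix.smul_mul, Matrix.trace_smul, Matrix.trace_fin_two,
        Matrix.mul_fin_two, Matrix.of_apply, Matrix.cons_val', Matrix.cons_val_zero,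
        Matrix.cons_val_one, Matrix.cons_val_fin_one, smul_eq_mul]
      ring
    rw [trace_eq, mul_pow, div_pow, Real.sq_sqrt zero_le_two]
    ring
  · have int_iff : (∃ z : ℤ, (((a : ℝ) - b) ^ 2 + 3) ^ 2 / 2 = (z : ℝ)) ↔
        Even (((a - b) ^ 2 + 3) ^ 2) := by
      rw [even_iff_two_dvd]
      refine exists_congr fun z => ?_
      rw [div_eq_iff two_ne_zero, mul_comm (z : ℝ)]
      exact_mod_cast Iff.rfl
    have not_even_three : ¬ Even (3 : ℤ) := by decide
    rw [int_iff, Int.even_pow' two_ne_zero, Int.even_add, Int.even_pow' two_ne_zero,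
      ← Int.not_even_iff_odd]
    simp only [not_even_three, iff_false]
end

section
/- For integers a and b, let h₃(a) = (1/√3)·[[a, −(a²+3)],[1, −a]] and h₁(b) = [[b, −(b²+1)],[1, −b]] in SL(2,ℝ). Then (tr(h₃(a)·h₁(b)))² = ((a−b)² + 4)²/3, and this real number is never an integer (since squares are congruent to 0 or 1 mod 3, 3 never divides (a−b)² + 4). -/
/-- The π-rotation about the marked point at height `√3` on the vertical side `[∞, a]`
of type 3. -/
noncomputable def h3 (a : ℤ) : Matrix (Fin 2) (Fin 2) ℝ :=
  (1 / Real.sqrt 3) • !![(a : ℝ), -((a : ℝ) ^ 2 + 3); 1, -(a : ℝ)]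

theorem three_not_dvd_sq_add_four (n : ℤ) : ¬(3 : ℤ) ∣ n ^ 2 + 4 := by
  intro h
  have hn : n % 3 = 0 ∨ n % 3 = 1 ∨ n % 3 = 2 := by omega
  rcases hn with hn | hn | hn <;> simp [Int.dvd_iff_emod_eq_zero, Int.add_emod, pow_two, Int.mul_emod, hn] at h

theorem trace_h3_mul_h1 (a b : ℤ) :
    (h3 a * h1 b).trace = -((((a : ℝ) - b) ^ 2 + 4) / Real.sqrt 3) := by
  simp [h3, h1, Matrix.trace_fin_two]
  ring

/-- For integers `a, b`, `(tr(h₃(a)·h₁(b)))² = ((a-b)² + 4)²/3`, and this real number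
is never an integer. -/
theorem stmt_16 (a b : ℤ) :
    ((h3 a * h1 b).trace) ^ 2 = (((a : ℝ) - b) ^ 2 + 4) ^ 2 / 3 ∧
    ¬∃ z : ℤ, (((a : ℝ) - b) ^ 2 + 4) ^ 2 / 3 = (z : ℝ) := by
  refine ⟨?_, ?_⟩
  · rw [trace_h3_mul_h1, neg_sq, div_pow, Real.sq_sqrt (by norm_num)]
  · rintro ⟨z, hz⟩
    rw [div_eq_iff (by norm_num)] at hz
    have hz' : ((a - b) ^ 2 + 4) ^ 2 = z * 3 := by exact_mod_cast hz
    exact three_not_dvd_sq_add_four (a - b)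
      (Int.prime_three.dvd_of_dvd_pow (Dvd.intro_left z hz'.symm))
end

section
/- For integers a and b, let h₃(a) = (1/√3)·[[a, −(a²+3)],[1, −a]] and h₃(b) = (1/√3)·[[b, −(b²+3)],[1, −b]] in SL(2,ℝ). Then (tr(h₃(a)·h₃(b)))² = ((a−b)² + 6)²/9, and this real number is an integer if and only if a ≡ b (mod 3). -/
theorem trace_h3_mul_h3 (a b : ℤ) :
    (h3 a * h3 b).trace = -(((a : ℝ) - b) ^ 2 + 6) / 3 := by
  have h : (1 / Real.sqrt 3) * (1 / Real.sqrt 3) = 1 / 3 := by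
    rw [div_mul_div_comm, Real.mul_self_sqrt (by norm_num), one_mul]
  simp only [h3, Matrix.smul_mul, Matrix.mul_smul, smul_smul, h, Matrix.trace_smul,
    Matrix.trace_fin_two, Matrix.mul_fin_two, Matrix.of_apply, Matrix.cons_val', Matrix.cons_val_zero,
    Matrix.cons_val_one, Matrix.cons_val_fin_one, smul_eq_mul]
  ring

theorem nine_dvd_sq_add_six_sq_iff (d : ℤ) : 9 ∣ (d ^ 2 + 6) ^ 2 ↔ 3 ∣ d := by
  rw [show (9 : ℤ) = 3 ^ 2 by norm_num, Int.pow_dvd_pow_iff two_ne_zero,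
    Int.dvd_add_left (by norm_num), Int.prime_three.dvd_pow_iff_dvd two_ne_zero]

/-- For integers `a, b`, `(tr(h₃(a)·h₃(b)))² = ((a-b)² + 6)²/9`, and this real number
is an integer if and only if `a ≡ b (mod 3)`. -/
theorem stmt_17 (a b : ℤ) :
    ((h3 a * h3 b).trace) ^ 2 = (((a : ℝ) - b) ^ 2 + 6) ^ 2 / 9 ∧
    ((∃ z : ℤ, (((a : ℝ) - b) ^ 2 + 6) ^ 2 / 9 = (z : ℝ)) ↔ a ≡ b [ZMOD 3]) := by
  refine ⟨by rw [trace_h3_mul_h3]; ring, ?_⟩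
  rw [Int.modEq_comm, Int.modEq_iff_dvd, ← nine_dvd_sq_add_six_sq_iff, dvd_def]
  refine exists_congr fun z => ?_
  rw [div_eq_iff (by norm_num), mul_comm (z : ℝ)]
  norm_cast
end
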